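/- Let H be a nontrivial complex Hilbert space, δ₀ > 0, and for each δ ∈ (−δ₀, δ₀) let A_δ be a bounded self-adjoint operator on H. Assume the family is (p2)-Lipschitz continuous: for every M > 0 the quantity sup |(‖αA_{δ₁}² + βA_{δ₁} + γI‖ − ‖αA_{δ₂}² + βA_{δ₂} + γI‖)| / |δ₁ − δ₂|, taken over all real α, β, γ with |α| + |β| + |γ| ≤ M and all δ₁ ≠ δ₂ in (−δ₀, δ₀), is finite. Let C denote the analogous supremum taken only over polynomials p(x) = x² + βx + γ with β, γ ∈ ℝ, |β| ≤ 2‖A₀‖ and |γ| ≤ 5‖A₀‖². Let (a, b) be a gap of the spectrum of A₀. Then there exists ε > 0 such that for every δ with |δ| < ε there is a gap (a_δ, b_δ) of the spectrum of A_δ with |a_δ − a| ≤ 3|δ|·C/(b − a) and |b_δ − b| ≤ 3|δ|·C/(b − a). -/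

import Mathlib

open Set

/-- A gap of the spectrum of a bounded (self-adjoint) operator `T`: a bounded connected
component `(a, b)` of `ℝ ∖ σ(T)`, i.e. `a < b`, both edges belong to the (real) spectrum and
the open interval is disjoint from it. -/
def IsSpectralGap {H : Type*} [NormedAddCommGroup H] [InnerProductSpace ℂ H]
    [CompleteSpace H] (T : H →L[ℂ] H) (a b : ℝ) : Prop :=
  a < b ∧ a ∈ spectrum ℝ T ∧ b ∈ spectrum ℝ T ∧ Set.Ioo a b ∩ spectrum ℝ T = ∅

/-- A compact set of reals missing a point `c`, with points on both sides of `c`, has a gap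
around `c`. -/
theorem IsCompact.exists_gap_around {S : Set ℝ} (hS : IsCompact S) {c u v : ℝ} (hc : c ∉ S)
    (hu : u ∈ S) (huc : u < c) (hv : v ∈ S) (hcv : c < v) :
    ∃ p ∈ S, ∃ q ∈ S, p < c ∧ c < q ∧ Ioo p q ∩ S = ∅ := by
  obtain ⟨p, ⟨hpS, hpc⟩, hp⟩ :=
    (hS.inter_right (isClosed_Iic (a := c))).exists_isGreatest ⟨u, hu, huc.le⟩
  obtain ⟨q, ⟨hqS, hcq⟩, hq⟩ :=
    (hS.inter_right (isClosed_Ici (a := c))).exists_isLeast ⟨v, hv, hcv.le⟩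
  refine ⟨p, hpS, q, hqS, lt_of_le_of_ne hpc fun h => hc (h ▸ hpS),
    lt_of_le_of_ne hcq fun h => hc (h ▸ hqS), ?_⟩
  rw [eq_empty_iff_forall_notMem]
  rintro x ⟨⟨hpx, hxq⟩, hxS⟩
  rcases le_total x c with h | h
  · exact hpx.not_ge (hp ⟨hxS, h⟩)
  · exact hxq.not_ge (hq ⟨hxS, h⟩)

section Quadratic

variable {E : Type*} [CStarAlgebra E]

theorem IsSelfAdjoint.cfc_quadratic {T : E} (hT : IsSelfAdjoint T) (β γ : ℝ) :
    cfc (fun x : ℝ => x * x + β * x + γ) T = T * T + β • T + γ • (1 : E) := by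
  rw [cfc_add (R := ℝ) T (fun x => x * x + β * x) (fun _ => γ),
    cfc_add (R := ℝ) T (fun x => x * x) (fun x => β * x),
    cfc_mul (R := ℝ) (fun x => x) (fun x => x) T, cfc_const_mul (R := ℝ) β (fun x => x) T,
    cfc_id' ℝ T, cfc_const γ T, Algebra.algebraMap_eq_smul_one]

theorem IsSelfAdjoint.abs_quadratic_le_norm {T : E} (hT : IsSelfAdjoint T) (β γ : ℝ) {x : ℝ}
    (hx : x ∈ spectrum ℝ T) : |x * x + β * x + γ| ≤ ‖T * T + β • T + γ • (1 : E)‖ := by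
  rw [← hT.cfc_quadratic]
  exact norm_apply_le_norm_cfc (fun x : ℝ => x * x + β * x + γ) T hx

theorem IsSelfAdjoint.exists_abs_quadratic_eq_norm [Nontrivial E] {T : E}
    (hT : IsSelfAdjoint T) (β γ : ℝ) :
    ∃ x ∈ spectrum ℝ T, |x * x + β * x + γ| = ‖T * T + β • T + γ • (1 : E)‖ := by
  rw [← hT.cfc_quadratic]
  exact (IsGreatest.norm_cfc (fun x : ℝ => x * x + β * x + γ) T).1

variable {S T : E} {c η m : ℝ}

/-- If the norms of `(T - c)² - 5m²` and `(S - c)² - 5m²` differ by at most `η`, then the squared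
distance from `c` to the spectrum drops by at most `η` from `S` to `T`. -/
theorem IsSelfAdjoint.sq_le_sq_sub_add_of_norm_quadratic_le [Nontrivial E]
    (hS : IsSelfAdjoint S) (hT : IsSelfAdjoint T)
    (hm : ∀ y ∈ spectrum ℝ S, |y| ≤ m) (hc : |c| ≤ m)
    (h : |‖T * T + (-2 * c) • T + (c ^ 2 - 5 * m ^ 2) • (1 : E)‖ -
      ‖S * S + (-2 * c) • S + (c ^ 2 - 5 * m ^ 2) • (1 : E)‖| ≤ η)
    {r : ℝ} (hr : ∀ y ∈ spectrum ℝ S, r ^ 2 ≤ (y - c) ^ 2)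
    {x : ℝ} (hx : x ∈ spectrum ℝ T) : r ^ 2 ≤ (x - c) ^ 2 + η := by
  obtain ⟨y, hy, hyn⟩ := hS.exists_abs_quadratic_eq_norm (-2 * c) (c ^ 2 - 5 * m ^ 2)
  have hxn := hT.abs_quadratic_le_norm (-2 * c) (c ^ 2 - 5 * m ^ 2) hx
  have hyc := abs_le.1 (hm y hy)
  have hcm := abs_le.1 hc
  have hry := hr y hy
  have hsq : (y - c) ^ 2 ≤ (2 * m) ^ 2 := by
    exact sq_le_sq' (by linarith) (by linarith)
  rw [← hyn, abs_of_nonpos (a := y * y + _ + _) (by nlinarith [sq_nonneg m])] at h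
  have h1 := (abs_le.1 h).2
  have h2 := (abs_le.1 hxn).1
  linarith

/-- If the norms of `(T - c)² - 5m²` and `(S - c)² - 5m²` differ by at most `η`, then the squared
distance from `c` to the spectrum grows by at most `η` from `S` to `T`. -/
theorem IsSelfAdjoint.exists_sq_sub_le_of_norm_quadratic_le [Nontrivial E]
    (hS : IsSelfAdjoint S) (hT : IsSelfAdjoint T) {m' : ℝ}
    (hm' : ∀ x ∈ spectrum ℝ T, |x| ≤ m') (hc : |c| ≤ m) (hmm' : (m' + m) ^ 2 + η < 6 * m ^ 2)
    (h : |‖T * T + (-2 * c) • T + (c ^ 2 - 5 * m ^ 2) • (1 : E)‖ -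
      ‖S * S + (-2 * c) • S + (c ^ 2 - 5 * m ^ 2) • (1 : E)‖| ≤ η)
    {y : ℝ} (hy : y ∈ spectrum ℝ S) (hyc : (y - c) ^ 2 ≤ 4 * m ^ 2) :
    ∃ x ∈ spectrum ℝ T, (x - c) ^ 2 ≤ (y - c) ^ 2 + η := by
  obtain ⟨x, hx, hxn⟩ := hT.exists_abs_quadratic_eq_norm (-2 * c) (c ^ 2 - 5 * m ^ 2)
  refine ⟨x, hx, ?_⟩
  have hyn := hS.abs_quadratic_le_norm (-2 * c) (c ^ 2 - 5 * m ^ 2) hy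
  have hsq : (x - c) ^ 2 ≤ (m' + m) ^ 2 :=
    sq_le_sq.2 (((abs_sub x c).trans (add_le_add (hm' x hx) hc)).trans (le_abs_self _))
  have h1 := (abs_le.1 h).1
  have h2 := (abs_le.1 hyn).1
  rw [← hxn] at h1
  rcases abs_cases (x * x + -2 * c * x + (c ^ 2 - 5 * m ^ 2)) with h3 | h3 <;> linarith

end Quadratic

/-- The interval `(a, b)` controls the gap of `S` around its midpoint, given estimates for the
squared distances from `S` to the midpoint and to the two quarter points of `[a, b]`. -/
theorem IsCompact.exists_gap_of_sq_dist {S : Set ℝ} (hS : IsCompact S) {a b η : ℝ}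
    (hab : a < b) (hη : 0 ≤ η) (hη' : 100 * η ≤ (b - a) ^ 2)
    (hmid : ∀ x ∈ S, ((b - a) / 2) ^ 2 ≤ (x - (a + b) / 2) ^ 2 + η)
    (ha : ∃ x ∈ S, (x - (a + (b - a) / 4)) ^ 2 ≤ (a - (a + (b - a) / 4)) ^ 2 + η)
    (hb : ∃ x ∈ S, (x - (b - (b - a) / 4)) ^ 2 ≤ (b - (b - (b - a) / 4)) ^ 2 + η) :
    ∃ p ∈ S, ∃ q ∈ S, p < q ∧ Ioo p q ∩ S = ∅ ∧
      |p - a| ≤ 3 * η / (b - a) ∧ |q - b| ≤ 3 * η / (b - a) := by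
  obtain ⟨D, rfl⟩ : ∃ D, b = a + D := ⟨b - a, by ring⟩
  have hD : 0 < D := by linarith
  simp only [add_sub_cancel_left] at *
  set t := 3 * η / D with ht
  have htD : t * D = 3 * η := by rw [ht]; field_simp
  have ht0 : 0 ≤ t := by positivity
  have htD' : 100 * t ≤ 3 * D := by nlinarith
  have hmid' : ∀ x ∈ S, x ≤ a + t ∨ a + D - t ≤ x := by
    intro x hx
    by_contra! h
    have := hmid x hx
    have h2 : (x - (a + (a + D)) / 2) ^ 2 < (D / 2 - t) ^ 2 :=
      sq_lt_sq' (by linarith) (by linarith)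
    nlinarith
  have hquarter : ∀ z : ℝ, z ^ 2 ≤ (D / 4) ^ 2 + η → |z| ≤ D / 4 + t := by
    intro z hz
    refine abs_le_of_sq_le_sq ?_ (by positivity)
    nlinarith
  obtain ⟨u, hu, hua⟩ := ha
  obtain ⟨v, hv, hvb⟩ := hb
  have hua' := abs_le.1 (hquarter _ (hua.trans_eq (by ring)))
  have hvb' := abs_le.1 (hquarter _ (hvb.trans_eq (by ring)))
  have hu1 : u ≤ a + t := (hmid' u hu).resolve_right fun h => by linarith
  have hv1 : a + D - t ≤ v := (hmid' v hv).resolve_left fun h => by linarith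
  obtain ⟨p, hp, q, hq, hpc, hcq, hpq⟩ := hS.exists_gap_around (c := a + D / 2)
    (fun h => by rcases hmid' _ h with h | h <;> linarith) hu (by linarith) hv (by linarith)
  have hgap : ∀ x ∈ S, x ≤ p ∨ q ≤ x := fun x hx => by
    by_contra! h
    exact (hpq ▸ (⟨h, hx⟩ : x ∈ Ioo p q ∩ S) : x ∈ (∅ : Set ℝ))
  have hup : u ≤ p := (hgap u hu).resolve_right fun h => by linarith
  have hqv : q ≤ v := (hgap v hv).resolve_left fun h => by linarith
  have hp1 : p ≤ a + t := (hmid' p hp).resolve_right fun h => by linarith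
  have hq1 : a + D - t ≤ q := (hmid' q hq).resolve_left fun h => by linarith
  exact ⟨p, hp, q, hq, hpc.trans hcq, hpq, abs_le.2 ⟨by linarith, by linarith⟩,
    abs_le.2 ⟨by linarith, by linarith⟩⟩

/-- Beckus–Bellissard lemma. Let `(A_δ)_{|δ|<δ₀}` be a `(p2)`-Lipschitz
continuous family of bounded self-adjoint operators, let `C` bound the Lipschitz constants of
`δ ↦ ‖A_δ² + βA_δ + γI‖` over `|β| ≤ 2‖A₀‖`, `|γ| ≤ 5‖A₀‖²`, and let `(a, b)` be a gap of the
spectrum of `A₀`.  Then for some `ε > 0` and all `|δ| < ε` the spectrum of `A_δ` has a gap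
`(a_δ, b_δ)` with `|a_δ − a| ≤ 3|δ|·C/(b−a)` and `|b_δ − b| ≤ 3|δ|·C/(b−a)`. -/
theorem beckus_bellissard_gap_edges
    (H : Type*) [NormedAddCommGroup H] [InnerProductSpace ℂ H] [CompleteSpace H]
    [Nontrivial H] (δ₀ : ℝ) (hδ₀ : 0 < δ₀) (A : ℝ → H →L[ℂ] H)
    (hsa : ∀ δ ∈ Ioo (-δ₀) δ₀, IsSelfAdjoint (A δ))
    (hp2 : ∀ M : ℝ, 0 < M → ∃ CM : ℝ,
      ∀ α β γ : ℝ, |α| + |β| + |γ| ≤ M →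
        ∀ δ₁ ∈ Ioo (-δ₀) δ₀, ∀ δ₂ ∈ Ioo (-δ₀) δ₀,
          |‖α • (A δ₁ * A δ₁) + β • A δ₁ + γ • (1 : H →L[ℂ] H)‖ -
            ‖α • (A δ₂ * A δ₂) + β • A δ₂ + γ • (1 : H →L[ℂ] H)‖| ≤ CM * |δ₁ - δ₂|)
    (C : ℝ)
    (hC : ∀ β γ : ℝ, |β| ≤ 2 * ‖A 0‖ → |γ| ≤ 5 * ‖A 0‖ ^ 2 →
      ∀ δ₁ ∈ Ioo (-δ₀) δ₀, ∀ δ₂ ∈ Ioo (-δ₀) δ₀,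
        |‖A δ₁ * A δ₁ + β • A δ₁ + γ • (1 : H →L[ℂ] H)‖ -
          ‖A δ₂ * A δ₂ + β • A δ₂ + γ • (1 : H →L[ℂ] H)‖| ≤ C * |δ₁ - δ₂|)
    (a b : ℝ) (hgap : IsSpectralGap (A 0) a b) :
    ∃ ε : ℝ, 0 < ε ∧ ε ≤ δ₀ ∧ ∀ δ : ℝ, |δ| < ε →
      ∃ aδ bδ : ℝ, IsSpectralGap (A δ) aδ bδ ∧
        |aδ - a| ≤ 3 * |δ| * C / (b - a) ∧ |bδ - b| ≤ 3 * |δ| * C / (b - a) := by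
  obtain ⟨hab, ha, hb, hgapS⟩ := hgap
  have h0 : (0 : ℝ) ∈ Ioo (-δ₀) δ₀ := ⟨by linarith, hδ₀⟩
  have hspec : ∀ δ, ∀ x ∈ spectrum ℝ (A δ), |x| ≤ ‖A δ‖ := fun δ x hx =>
    spectrum.norm_le_norm_of_mem hx
  obtain ⟨L, hL⟩ := hp2 1 one_pos
  set m := ‖A 0‖
  have ham := abs_le.1 (hspec 0 a ha)
  have hbm := abs_le.1 (hspec 0 b hb)
  have hm : 0 < m := by linarith
  set κ := min ((b - a) ^ 2 / 100) (min (m ^ 2 / 2) (m / 10)) with hκ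
  have hκ0 : 0 < κ := by
    have := sub_pos.2 hab
    positivity
  have hκ1 : κ ≤ (b - a) ^ 2 / 100 := min_le_left _ _
  have hκ2 : κ ≤ m ^ 2 / 2 := (min_le_right _ _).trans (min_le_left _ _)
  have hκ3 : κ ≤ m / 10 := (min_le_right _ _).trans (min_le_right _ _)
  have hden : 0 < |C| + |L| + 1 := by positivity
  refine ⟨min δ₀ (κ / (|C| + |L| + 1)), by positivity, min_le_left _ _, fun δ hδ => ?_⟩
  have hδm : δ ∈ Ioo (-δ₀) δ₀ := abs_lt.1 (hδ.trans_le (min_le_left _ _))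
  have hδκ : |δ| * (|C| + |L| + 1) < κ :=
    (lt_div_iff₀ hden).1 (hδ.trans_le (min_le_right _ _))
  have hCκ : C * |δ| ≤ κ := by
    nlinarith [mul_le_mul_of_nonneg_right (le_abs_self C) (abs_nonneg δ),
      mul_nonneg (abs_nonneg δ) (abs_nonneg L), abs_nonneg δ]
  have hLκ : L * |δ| ≤ κ := by
    nlinarith [mul_le_mul_of_nonneg_right (le_abs_self L) (abs_nonneg δ),
      mul_nonneg (abs_nonneg δ) (abs_nonneg C), abs_nonneg δ]
  have hnorm : ‖A δ‖ ≤ 11 / 10 * m := by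
    have := hL 0 1 0 (by norm_num) δ hδm 0 h0
    simp only [zero_smul, zero_add, one_smul, add_zero, sub_zero] at this
    linarith [(abs_le.1 this).2]
  have hquad : ∀ c : ℝ, |c| ≤ m →
      |‖A δ * A δ + (-2 * c) • A δ + (c ^ 2 - 5 * m ^ 2) • (1 : H →L[ℂ] H)‖ -
        ‖A 0 * A 0 + (-2 * c) • A 0 + (c ^ 2 - 5 * m ^ 2) • (1 : H →L[ℂ] H)‖| ≤ C * |δ| := by
    intro c hc
    have hc2 : c ^ 2 ≤ m ^ 2 := sq_le_sq' (abs_le.1 hc).1 (abs_le.1 hc).2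
    have := hC (-2 * c) (c ^ 2 - 5 * m ^ 2) (by rw [abs_mul]; norm_num; exact hc)
      (abs_le.2 ⟨by nlinarith, by nlinarith⟩) δ hδm 0 h0
    rwa [sub_zero] at this
  have hη : 0 ≤ C * |δ| := (abs_nonneg _).trans (hquad 0 (by simpa using hm.le))
  have hlow : ∀ c y : ℝ, |c| ≤ m → y ∈ spectrum ℝ (A 0) →
      ∃ x ∈ spectrum ℝ (A δ), (x - c) ^ 2 ≤ (y - c) ^ 2 + C * |δ| := by
    intro c y hc hy
    have hy' := abs_le.1 (hspec 0 y hy)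
    have hc' := abs_le.1 hc
    refine (hsa 0 h0).exists_sq_sub_le_of_norm_quadratic_le (hsa δ hδm)
      (fun x hx => (hspec δ x hx).trans hnorm) hc (by nlinarith) (hquad c hc) hy ?_
    have := sq_le_sq' (a := y - c) (b := 2 * m) (by linarith) (by linarith)
    linarith
  have hmid : |(a + b) / 2| ≤ m := abs_le.2 ⟨by linarith, by linarith⟩
  have hdist : ∀ y ∈ spectrum ℝ (A 0), ((b - a) / 2) ^ 2 ≤ (y - (a + b) / 2) ^ 2 := by
    intro y hy
    have hy' : y ≤ a ∨ b ≤ y := by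
      by_contra! h
      exact (hgapS ▸ (⟨h, hy⟩ : y ∈ Ioo a b ∩ _) : y ∈ (∅ : Set ℝ))
    rcases hy' with h | h <;> nlinarith
  obtain ⟨p, hp, q, hq, hpq, hgap', h1, h2⟩ :=
    (spectrum.isCompact (𝕜 := ℝ) (A δ)).exists_gap_of_sq_dist hab hη (by linarith)
      (fun x hx => (hsa 0 h0).sq_le_sq_sub_add_of_norm_quadratic_le (hsa δ hδm) (hspec 0) hmid
        (hquad _ hmid) hdist hx)
      (hlow _ a (abs_le.2 ⟨by linarith, by linarith⟩) ha)
      (hlow _ b (abs_le.2 ⟨by linarith, by linarith⟩) hb)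
  rw [show 3 * (C * |δ|) = 3 * |δ| * C by ring] at h1 h2
  exact ⟨p, q, ⟨hpq, hp, hq, hgap'⟩, h1, h2⟩
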